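/- In the setting of the short exact sequence theorem, the Hilbert series of M_a = Syz_R(X^a V₁,…,X^a V_m, V_{m+1},…,V_{m+l}) satisfies H_{M_a}(t) = ((t^{αr} - t^{αd})·H_{𝒮_q}(t) + (1 - t^{αr})·H_{𝒮_{q+1}}(t)) / (1 - t^{αd}), where a = dq + r with 0 ≤ r ≤ d-1. -/

import Mathlib

open MvPolynomial

set_option synthInstance.maxHeartbeats 1000000
set_option maxHeartbeats 1000000

noncomputable section

/-- The linear map sending a tuple `s` to `∑ i, s i * g i`. -/
def syzMap {R : Type*} [CommRing R] {N : ℕ} (g : Fin N → R) : (Fin N → R) →ₗ[R] R where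
  toFun s := ∑ i, s i * g i
  map_add' := by intro s t; simp [add_mul, Finset.sum_add_distrib]
  map_smul' := by intro c s; simp [Finset.mul_sum, mul_assoc]

/-- The first syzygy module of `g 0, …, g (N-1)`. -/
def SyzOf {R : Type*} [CommRing R] {N : ℕ} (g : Fin N → R) : Submodule R (Fin N → R) :=
  LinearMap.ker (syzMap g)

/-- The degree-`j` part of the quotient `A/I` of a weighted-graded polynomial ring:
the image of the weighted-homogeneous polynomials of degree `j`. -/
def qpiece (k : Type*) [Field k] {ν : ℕ} (w : Fin ν → ℤ) (I : Ideal (MvPolynomial (Fin ν) k))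
    (j : ℤ) : Submodule k (MvPolynomial (Fin ν) k ⧸ I) :=
  Submodule.map (Ideal.Quotient.mkₐ k I).toLinearMap (weightedHomogeneousSubmodule k w j)

/-- The degree-`t` graded piece of the syzygy module `Syz(g) ⊆ ⊕ᵢ (A/I)(-D i)`:
syzygies whose `i`-th component is homogeneous of degree `t - D i`. -/
def gradedPiece {k : Type*} [Field k] {ν : ℕ} (w : Fin ν → ℤ)
    (I : Ideal (MvPolynomial (Fin ν) k)) {N : ℕ}
    (g : Fin N → MvPolynomial (Fin ν) k ⧸ I) (D : Fin N → ℤ) (t : ℤ) :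
    Submodule k (Fin N → MvPolynomial (Fin ν) k ⧸ I) :=
  (SyzOf g).restrictScalars k ⊓
    ⨅ i, Submodule.comap (LinearMap.proj i) (qpiece k w I (t - D i))

/-- The Hilbert series `H_M(t) = ∑ dim_k(M_j)·t^j ∈ ℚ⟦t⟧` of the graded syzygy
module `Syz(g) ⊆ ⊕ᵢ (A/I)(-D i)`. -/
def hkSeries (k : Type*) [Field k] {ν : ℕ} (w : Fin ν → ℤ)
    (I : Ideal (MvPolynomial (Fin ν) k)) {N : ℕ}
    (g : Fin N → MvPolynomial (Fin ν) k ⧸ I) (D : Fin N → ℤ) : PowerSeries ℚ :=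
  PowerSeries.mk fun j : ℕ => (Module.finrank k (gradedPiece w I g D (j : ℤ)) : ℚ)

/-- The generators `x^c·v₁, …, x^c·v_m, v_{m+1}, …, v_{m+l}`. -/
def genTup (m l : ℕ) {R : Type*} [CommRing R] (x : R) (c : ℕ) (v : Fin (m + l) → R) :
    Fin (m + l) → R :=
  fun j => if (j : ℕ) < m then x ^ c * v j else v j

/-- The (total) degrees of the generators `genTup`: the first `m` get an extra `e`. -/
def degTup (m l : ℕ) (e : ℤ) (dv : Fin (m + l) → ℤ) : Fin (m + l) → ℤ :=
  fun j => if (j : ℕ) < m then e + dv j else dv j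

section Weights

variable {k : Type*} [Field k] {n : ℕ}

lemma weight_cons (w : Fin (n + 1) → ℤ) (e : ℕ) (μ : Fin n →₀ ℕ) :
    Finsupp.weight w (Finsupp.cons e μ) = e * w 0 + Finsupp.weight (w ∘ Fin.succ) μ := by
  simp [Finsupp.weight_apply, Finsupp.sum_fintype, Fin.sum_univ_succ]

lemma isWeightedHomogeneous_rename_iff {σ τ : Type*} {f : σ → τ} (hf : Function.Injective f)
    (w : τ → ℤ) (p : MvPolynomial σ k) (t : ℤ) :
    IsWeightedHomogeneous w (rename f p) t ↔ IsWeightedHomogeneous (w ∘ f) p t := by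
  have hwt : ∀ μ : σ →₀ ℕ, Finsupp.weight w (μ.mapDomain f) = Finsupp.weight (w ∘ f) μ :=
    fun μ => Finsupp.linearCombination_mapDomain ℕ f μ
  constructor
  · intro h μ hμ
    rw [← hwt]
    exact h (by rwa [coeff_rename_mapDomain f hf])
  · intro h μ hμ
    obtain ⟨ν, rfl, hν⟩ := coeff_rename_ne_zero f p μ hμ
    rw [hwt]
    exact h hν

lemma exists_rename_succ_eq {p : MvPolynomial (Fin (n + 1)) k} (hp : ∀ μ ∈ p.support, μ 0 = 0) :
    ∃ p₀ : MvPolynomial (Fin n) k, rename Fin.succ p₀ = p := by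
  refine exists_rename_eq_of_vars_subset_range p _ (Fin.succ_injective n) fun i hi => ?_
  obtain ⟨μ, hμ, hi⟩ := (mem_vars_iff_mem_support i).1 (Finset.mem_coe.1 hi)
  rw [Fin.range_succ]
  rintro rfl
  exact (Finsupp.mem_support_iff.1 hi) (hp μ hμ)

lemma finite_weightedHomogeneousSubmodule (w : Fin n → ℕ) (hw : ∀ i, 1 ≤ w i) (t : ℤ) :
    Module.Finite k (weightedHomogeneousSubmodule k (fun i => (w i : ℤ)) t) := by
  have hwt : ∀ μ : Fin n →₀ ℕ,
      Finsupp.weight (fun i => (w i : ℤ)) μ = (Finsupp.weight w μ : ℕ) := by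
    intro μ
    simp [Finsupp.weight_apply, Finsupp.sum_fintype]
  have hfin : {μ : Fin n →₀ ℕ | Finsupp.weight (fun i => (w i : ℤ)) μ = t}.Finite := by
    refine (Finsupp.finite_of_nat_weight_le w (fun i => by have := hw i; omega) t.toNat).subset ?_
    intro μ hμ
    simp only [Set.mem_ofPred_eq, hwt] at hμ ⊢
    omega
  have : Finite {μ : Fin n →₀ ℕ | Finsupp.weight (fun i => (w i : ℤ)) μ = t} := hfin
  rw [weightedHomogeneousSubmodule_eq_finsupp_supported]
  exact Module.Finite.equiv
    ((AddMonoidAlgebra.supportedEquivFinsupp _).symm)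

lemma eq_zero_of_isWeightedHomogeneous_neg {w : Fin n → ℤ} (hw : ∀ i, 0 ≤ w i)
    {p : MvPolynomial (Fin n) k} {t : ℤ} (hp : IsWeightedHomogeneous w p t) (ht : t < 0) :
    p = 0 := by
  ext μ
  by_contra hμ
  have := hp hμ
  have h0 : 0 ≤ Finsupp.weight w μ := by
    simp only [Finsupp.weight_apply, Finsupp.sum_fintype, zero_smul, implies_true]
    exact Finset.sum_nonneg fun i _ => by have := hw i; positivity
  omega

end Weights

section NormalForm

variable {k : Type*} [Field k] {n : ℕ}

/-- The map `(b₀, …, b_{d-1}) ↦ ∑ⱼ bⱼ Xʲ` from tuples of polynomials in the `Yᵢ` to the quotient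
`k[X, Y₁, …, Yₙ]/I`. -/
def powerSum (d : ℕ) (I : Ideal (MvPolynomial (Fin (n + 1)) k)) :
    (Fin d → MvPolynomial (Fin n) k) →ₗ[k] MvPolynomial (Fin (n + 1)) k ⧸ I where
  toFun b := Ideal.Quotient.mkₐ k I (∑ j, rename Fin.succ (b j) * X 0 ^ (j : ℕ))
  map_add' b c := by simp [add_mul, Finset.sum_add_distrib]
  map_smul' a b := by simp [Finset.smul_sum]

lemma powerSum_apply (d : ℕ) (I : Ideal (MvPolynomial (Fin (n + 1)) k))
    (b : Fin d → MvPolynomial (Fin n) k) :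
    powerSum d I b = ∑ j, Ideal.Quotient.mk I (rename Fin.succ (b j)) *
      Ideal.Quotient.mk I (X 0) ^ (j : ℕ) := by
  simp [powerSum]

lemma finSuccEquiv_rename_succ (p : MvPolynomial (Fin n) k) :
    finSuccEquiv k n (rename Fin.succ p) = Polynomial.C p := by
  induction p using MvPolynomial.induction_on with
  | C a => simp [finSuccEquiv_apply]
  | add p q hp hq => simp [hp, hq]
  | mul_X p i hp => simp [hp, finSuccEquiv_X_succ]

lemma powerSum_injective {d : ℕ} {F : MvPolynomial (Fin n) k}
    {I : Ideal (MvPolynomial (Fin (n + 1)) k)}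
    (hI : I = Ideal.span {X 0 ^ d - rename Fin.succ F}) :
    Function.Injective (powerSum d I) := by
  subst hI
  rw [injective_iff_map_eq_zero]
  intro b hb
  have hdvd : X 0 ^ d - rename Fin.succ F ∣ ∑ j, rename Fin.succ (b j) * X 0 ^ (j : ℕ) :=
    Ideal.mem_span_singleton.1 (Ideal.Quotient.eq_zero_iff_mem.1 hb)
  have hdvd' := map_dvd (finSuccEquiv k n) hdvd
  simp only [map_sub, map_pow, map_sum, map_mul, finSuccEquiv_rename_succ,
    finSuccEquiv_X_zero] at hdvd'
  rcases Nat.eq_zero_or_pos d with rfl | hd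
  · exact Subsingleton.elim _ _
  have hdeg : (∑ j : Fin d, Polynomial.C (b j) * Polynomial.X ^ (j : ℕ)).degree <
      (d : WithBot ℕ) := by
    refine (Polynomial.degree_sum_le _ _).trans_lt ((Finset.sup_lt_iff (WithBot.bot_lt_coe d)).2 ?_)
    intro j _
    exact (Polynomial.degree_C_mul_X_pow_le _ _).trans_lt (Nat.cast_lt.2 j.2)
  have hzero := Polynomial.eq_zero_of_dvd_of_degree_lt hdvd'
    (by rwa [Polynomial.degree_X_pow_sub_C hd])
  funext j
  have := congrArg (fun p => Polynomial.coeff p (j : ℕ)) hzero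
  simpa [Polynomial.finsetSum_coeff, Polynomial.coeff_C_mul, Polynomial.coeff_X_pow,
    Fin.val_inj] using this

lemma mk_X_pow_eq {d : ℕ} {F : MvPolynomial (Fin (n + 1)) k}
    {I : Ideal (MvPolynomial (Fin (n + 1)) k)} (hI : I = Ideal.span {X 0 ^ d - F}) :
    Ideal.Quotient.mk I (X 0) ^ d = Ideal.Quotient.mk I F := by
  rw [← map_pow, Ideal.Quotient.eq, hI]
  exact Ideal.mem_span_singleton_self _

lemma powerSum_mem_qpiece {d : ℕ} (I : Ideal (MvPolynomial (Fin (n + 1)) k))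
    (w : Fin (n + 1) → ℤ) (b : Fin d → MvPolynomial (Fin n) k) (t : ℤ)
    (hb : ∀ j : Fin d, IsWeightedHomogeneous (w ∘ Fin.succ) (b j) (t - w 0 * (j : ℕ))) :
    powerSum d I b ∈ qpiece k w I t := by
  refine Submodule.mem_map_of_mem (IsWeightedHomogeneous.sum _ _ _ fun j _ => ?_)
  have h := ((isWeightedHomogeneous_rename_iff (Fin.succ_injective n) w _ _).2 (hb j)).mul
    ((isWeightedHomogeneous_X k w 0).pow (j : ℕ))
  convert h using 1
  simp only [nsmul_eq_mul]
  ring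

lemma exists_powerSum_eq_of_mem_qpiece {d : ℕ} (hd : 1 ≤ d) (w : Fin (n + 1) → ℤ)
    {F : MvPolynomial (Fin n) k} (hF : IsWeightedHomogeneous (w ∘ Fin.succ) F (d * w 0))
    {I : Ideal (MvPolynomial (Fin (n + 1)) k)}
    (hI : I = Ideal.span {X 0 ^ d - rename Fin.succ F})
    {t : ℤ} {y : MvPolynomial (Fin (n + 1)) k ⧸ I} (hy : y ∈ qpiece k w I t) :
    ∃ b : Fin d → MvPolynomial (Fin n) k,
      (∀ j : Fin d, IsWeightedHomogeneous (w ∘ Fin.succ) (b j) (t - w 0 * (j : ℕ))) ∧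
      powerSum d I b = y := by
  let S : Submodule k (MvPolynomial (Fin (n + 1)) k ⧸ I) := Submodule.map (powerSum d I)
    (Submodule.pi Set.univ fun j : Fin d =>
      weightedHomogeneousSubmodule k (w ∘ Fin.succ) (t - w 0 * (j : ℕ)))
  suffices hS : y ∈ S by
    obtain ⟨b, hb, rfl⟩ := hS
    exact ⟨b, fun j => hb j trivial, rfl⟩
  obtain ⟨p, hp, rfl⟩ := hy
  rw [p.as_sum, map_sum]
  refine Submodule.sum_mem _ fun μ hμ => ?_
  have hwμ : Finsupp.weight w μ = t := hp (mem_support_iff.1 hμ)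
  rw [← Finsupp.cons_tail μ, weight_cons] at hwμ
  have hx := mk_X_pow_eq hI
  have hlt : μ 0 % d < d := Nat.mod_lt _ hd
  refine ⟨Pi.single ⟨μ 0 % d, hlt⟩ (monomial μ.tail (p.coeff μ) * F ^ (μ 0 / d)), ?_, ?_⟩
  · intro j _
    by_cases hj : j = ⟨μ 0 % d, hlt⟩
    · subst hj
      rw [Pi.single_eq_same]
      have h := (isWeightedHomogeneous_monomial (w ∘ Fin.succ) μ.tail (p.coeff μ) rfl).mul
        (hF.pow (μ 0 / d))
      have hdiv : ((μ 0 % d : ℕ) : ℤ) + d * (μ 0 / d : ℕ) = (μ 0 : ℕ) := by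
        exact_mod_cast Nat.mod_add_div (μ 0) d
      have e : Finsupp.weight (w ∘ Fin.succ) μ.tail + (μ 0 / d) • (d * w 0) =
          t - w 0 * (μ 0 % d : ℕ) := by
        rw [nsmul_eq_mul, ← hwμ, ← hdiv]
        ring
      rw [e] at h
      exact h
    · rw [Pi.single_eq_of_ne hj]
      exact isWeightedHomogeneous_zero _ _ _
  · rw [powerSum_apply, Finset.sum_eq_single ⟨μ 0 % d, hlt⟩ _ (by simp)]
    · have hmon : monomial μ (p.coeff μ) =
          rename Fin.succ (monomial μ.tail (p.coeff μ)) * X 0 ^ (μ 0) := by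
        apply (finSuccEquiv k n).injective
        rw [map_mul, finSuccEquiv_rename_succ, map_pow, finSuccEquiv_X_zero]
        ext i ν
        rw [finSuccEquiv_coeff_coeff, Polynomial.coeff_C_mul, Polynomial.coeff_X_pow, coeff_monomial]
        by_cases hi : i = μ 0
        · subst hi
          rw [if_pos rfl, mul_one, coeff_monomial]
          congr 1
          nth_rw 1 [← Finsupp.cons_tail μ]
          rw [(Finsupp.cons_right_injective _).eq_iff]
        · rw [if_neg hi, mul_zero, if_neg, coeff_zero]
          rintro rfl
          simp at hi
      rw [hmon]
      simp only [Pi.single_eq_same, AlgHom.toLinearMap_apply, Ideal.Quotient.mkₐ_eq_mk, map_mul,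
        map_pow, ← hx]
      conv_rhs => rw [← Nat.mod_add_div (μ 0) d, pow_add, pow_mul]
      ring
    · intro j _ hj
      rw [Pi.single_eq_of_ne hj]
      simp

end NormalForm

section Syzygies

variable {k : Type*} [Field k] {n N : ℕ}

/-- The degree-`t` part of the syzygy module of `g` over the polynomial ring, the `i`-th generator
being placed in degree `D i`. -/
def polySyz (w : Fin n → ℤ) (g : Fin N → MvPolynomial (Fin n) k) (D : Fin N → ℤ) (t : ℤ) :
    Submodule k (Fin N → MvPolynomial (Fin n) k) :=
  (SyzOf g).restrictScalars k ⊓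
    Submodule.pi Set.univ fun i => weightedHomogeneousSubmodule k w (t - D i)

/-- The Hilbert series of the graded syzygy module of `g` over the polynomial ring. -/
def polySyzSeries (w : Fin n → ℤ) (g : Fin N → MvPolynomial (Fin n) k) (D : Fin N → ℤ) :
    PowerSeries ℚ :=
  PowerSeries.mk fun t : ℕ => (Module.finrank k (polySyz w g D t) : ℚ)

lemma mem_polySyz {w : Fin n → ℤ} {g : Fin N → MvPolynomial (Fin n) k} {D : Fin N → ℤ} {t : ℤ}
    {c : Fin N → MvPolynomial (Fin n) k} :
    c ∈ polySyz w g D t ↔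
      ∑ i, c i * g i = 0 ∧ ∀ i, IsWeightedHomogeneous w (c i) (t - D i) := by
  simp [polySyz, SyzOf, syzMap, Submodule.mem_pi]

lemma mem_gradedPiece {w : Fin n → ℤ} {I : Ideal (MvPolynomial (Fin n) k)}
    {g : Fin N → MvPolynomial (Fin n) k ⧸ I} {D : Fin N → ℤ} {t : ℤ}
    {s : Fin N → MvPolynomial (Fin n) k ⧸ I} :
    s ∈ gradedPiece w I g D t ↔ ∑ i, s i * g i = 0 ∧ ∀ i, s i ∈ qpiece k w I (t - D i) := by
  simp [gradedPiece, SyzOf, syzMap, Submodule.mem_iInf]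

lemma finite_polySyz (w : Fin n → ℕ) (hw : ∀ i, 1 ≤ w i) (g : Fin N → MvPolynomial (Fin n) k)
    (D : Fin N → ℤ) (t : ℤ) : Module.Finite k (polySyz (fun i => (w i : ℤ)) g D t) := by
  have := fun i => finite_weightedHomogeneousSubmodule (k := k) w hw (t - D i)
  let f : polySyz (fun i => (w i : ℤ)) g D t →ₗ[k]
      (i : Fin N) → weightedHomogeneousSubmodule k (fun i => (w i : ℤ)) (t - D i) :=
    LinearMap.pi fun i =>
      ((LinearMap.proj i).comp (Submodule.subtype _)).codRestrict _ fun c => (mem_polySyz.1 c.2).2 i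
  refine Module.Finite.of_injective f fun c c' h => Subtype.ext (funext fun i => ?_)
  exact congrArg Subtype.val (congrFun h i)

lemma finrank_polySyz_of_neg {w : Fin n → ℤ} (hw : ∀ i, 0 ≤ w i)
    (g : Fin N → MvPolynomial (Fin n) k) {D : Fin N → ℤ} (hD : ∀ i, 0 ≤ D i) {t : ℤ}
    (ht : t < 0) : Module.finrank k (polySyz w g D t) = 0 := by
  have hbot : polySyz w g D t = ⊥ := by
    rw [eq_bot_iff]
    intro c hc
    refine (Submodule.mem_bot k).2 (funext fun i => ?_)
    exact eq_zero_of_isWeightedHomogeneous_neg hw ((mem_polySyz.1 hc).2 i) (by have := hD i; omega)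
  rw [hbot, finrank_bot]

/-- Distributes a family `c j` of tuples over the powers of `X`, the `i`-th entry of `c j` being
the coefficient of `X ^ σ i j` in the `i`-th entry of the result. -/
def assemble {d : ℕ} (I : Ideal (MvPolynomial (Fin (n + 1)) k)) (σ : Fin N → Equiv.Perm (Fin d)) :
    (Fin d → Fin N → MvPolynomial (Fin n) k) →ₗ[k] Fin N → MvPolynomial (Fin (n + 1)) k ⧸ I where
  toFun c i := powerSum d I fun j => c ((σ i).symm j) i
  map_add' _ _ := funext fun _ => map_add (powerSum d I) _ _
  map_smul' a _ := funext fun _ => map_smul (powerSum d I) a _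

lemma assemble_apply {d : ℕ} (I : Ideal (MvPolynomial (Fin (n + 1)) k))
    (σ : Fin N → Equiv.Perm (Fin d)) (c : Fin d → Fin N → MvPolynomial (Fin n) k) (i : Fin N) :
    assemble I σ c i = powerSum d I fun j => c ((σ i).symm j) i := rfl

lemma assemble_injective {d : ℕ} {F : MvPolynomial (Fin n) k}
    {I : Ideal (MvPolynomial (Fin (n + 1)) k)}
    (hI : I = Ideal.span {X 0 ^ d - rename Fin.succ F}) (σ : Fin N → Equiv.Perm (Fin d)) :
    Function.Injective (assemble I σ) := by
  intro c c' h
  funext j i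
  have := congrFun (powerSum_injective hI (congrFun h i)) (σ i j)
  simpa using this

lemma sum_assemble_mul {d : ℕ} {I : Ideal (MvPolynomial (Fin (n + 1)) k)}
    {σ : Fin N → Equiv.Perm (Fin d)} {g : Fin N → MvPolynomial (Fin (n + 1)) k ⧸ I}
    {G : Fin d → Fin N → MvPolynomial (Fin n) k}
    (hg : ∀ i j, Ideal.Quotient.mk I (X 0) ^ (σ i j : ℕ) * g i =
      Ideal.Quotient.mk I (rename Fin.succ (G j i)) * Ideal.Quotient.mk I (X 0) ^ (j : ℕ))
    (c : Fin d → Fin N → MvPolynomial (Fin n) k) :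
    ∑ i, assemble I σ c i * g i = powerSum d I fun j => ∑ i, c j i * G j i := by
  simp only [assemble_apply, powerSum_apply, map_sum, map_mul, Finset.sum_mul]
  rw [Finset.sum_comm (γ := Fin d)]
  refine Finset.sum_congr rfl fun i _ => ?_
  rw [← Equiv.sum_comp (σ i)]
  refine Finset.sum_congr rfl fun j _ => ?_
  rw [Equiv.symm_apply_apply, mul_assoc, hg, mul_assoc]

lemma finrank_gradedPiece {d : ℕ} (hd : 1 ≤ d) (w : Fin (n + 1) → ℕ) (hw : ∀ i, 1 ≤ w i)
    {F : MvPolynomial (Fin n) k}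
    (hF : IsWeightedHomogeneous (fun i => (w (Fin.succ i) : ℤ)) F (d * w 0))
    {I : Ideal (MvPolynomial (Fin (n + 1)) k)}
    (hI : I = Ideal.span {X 0 ^ d - rename Fin.succ F})
    (σ : Fin N → Equiv.Perm (Fin d)) {g : Fin N → MvPolynomial (Fin (n + 1)) k ⧸ I}
    {G : Fin d → Fin N → MvPolynomial (Fin n) k}
    (hg : ∀ i j, Ideal.Quotient.mk I (X 0) ^ (σ i j : ℕ) * g i =
      Ideal.Quotient.mk I (rename Fin.succ (G j i)) * Ideal.Quotient.mk I (X 0) ^ (j : ℕ))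
    {D : Fin N → ℤ} {E : Fin d → Fin N → ℤ}
    (hE : ∀ i j, D i + w 0 * (σ i j : ℕ) = w 0 * (j : ℕ) + E j i) (t : ℤ) :
    Module.finrank k (gradedPiece (fun i => (w i : ℤ)) I g D t) =
      ∑ j : Fin d, Module.finrank k
        (polySyz (fun i => (w (Fin.succ i) : ℤ)) (G j) (E j) (t - w 0 * (j : ℕ))) := by
  let P := fun j : Fin d =>
    polySyz (fun i => (w (Fin.succ i) : ℤ)) (G j) (E j) (t - w 0 * (j : ℕ))
  have hfin : ∀ j, Module.Finite k (P j) := fun j =>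
    finite_polySyz (fun i => w (Fin.succ i)) (fun i => hw _) _ _ _
  let Ψ : ((j : Fin d) → P j) →ₗ[k] Fin N → MvPolynomial (Fin (n + 1)) k ⧸ I :=
    (assemble I σ).comp (LinearMap.pi fun j => (P j).subtype.comp (LinearMap.proj j))
  have hΨ : Function.Injective Ψ := fun c c' h =>
    funext fun j => Subtype.ext (congrFun (assemble_injective hI σ h) j)
  have hrange : LinearMap.range Ψ = gradedPiece (fun i => (w i : ℤ)) I g D t := by
    ext s
    rw [mem_gradedPiece]
    constructor
    · rintro ⟨c, rfl⟩
      refine ⟨?_, fun i => powerSum_mem_qpiece I _ _ _ fun j => ?_⟩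
      · refine (sum_assemble_mul hg _).trans ?_
        rw [← map_zero (powerSum d I)]
        exact congrArg _ (funext fun j => (mem_polySyz.1 (c j).2).1)
      · have h := (mem_polySyz.1 (c ((σ i).symm j)).2).2 i
        have e := hE i ((σ i).symm j)
        rw [Equiv.apply_symm_apply] at e
        rw [show t - D i - (w 0 : ℤ) * (j : ℕ) =
          t - w 0 * ((σ i).symm j : ℕ) - E ((σ i).symm j) i by linarith]
        exact h
    · rintro ⟨hs, hdeg⟩
      choose b hb hbs using fun i =>
        exists_powerSum_eq_of_mem_qpiece hd (fun i => (w i : ℤ)) hF hI (hdeg i)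
      have hs' : assemble I σ (fun j i => b i (σ i j)) = s := by
        funext i
        simp [assemble_apply, hbs]
      rw [← hs', sum_assemble_mul hg] at hs
      have hsyz := powerSum_injective hI (hs.trans (map_zero _).symm)
      refine ⟨fun j => ⟨fun i => b i (σ i j), mem_polySyz.2 ⟨congrFun hsyz j, fun i => ?_⟩⟩, hs'⟩
      rw [show t - (w 0 : ℤ) * (j : ℕ) - E j i = t - D i - w 0 * (σ i j : ℕ) by linarith [hE i j]]
      exact hb i (σ i j)
  rw [← hrange, LinearMap.finrank_range_of_inj hΨ, Module.finrank_pi_fintype]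

lemma hkSeries_eq_sum {d : ℕ} (hd : 1 ≤ d) (w : Fin (n + 1) → ℕ) (hw : ∀ i, 1 ≤ w i)
    {F : MvPolynomial (Fin n) k}
    (hF : IsWeightedHomogeneous (fun i => (w (Fin.succ i) : ℤ)) F (d * w 0))
    {I : Ideal (MvPolynomial (Fin (n + 1)) k)}
    (hI : I = Ideal.span {X 0 ^ d - rename Fin.succ F})
    (σ : Fin N → Equiv.Perm (Fin d)) {g : Fin N → MvPolynomial (Fin (n + 1)) k ⧸ I}
    {G : Fin d → Fin N → MvPolynomial (Fin n) k}
    (hg : ∀ i j, Ideal.Quotient.mk I (X 0) ^ (σ i j : ℕ) * g i =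
      Ideal.Quotient.mk I (rename Fin.succ (G j i)) * Ideal.Quotient.mk I (X 0) ^ (j : ℕ))
    {D : Fin N → ℤ} {E : Fin d → Fin N → ℤ} (hE0 : ∀ j i, 0 ≤ E j i)
    (hE : ∀ i j, D i + w 0 * (σ i j : ℕ) = w 0 * (j : ℕ) + E j i) :
    hkSeries k (fun i => (w i : ℤ)) I g D =
      ∑ j : Fin d, (PowerSeries.X ^ w 0) ^ (j : ℕ) *
        polySyzSeries (fun i => (w (Fin.succ i) : ℤ)) (G j) (E j) := by
  ext t
  simp only [hkSeries, polySyzSeries, PowerSeries.coeff_mk, map_sum, ← pow_mul, PowerSeries.coeff_X_pow_mul',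
    finrank_gradedPiece hd w hw hF hI σ hg hE, Nat.cast_sum]
  refine Finset.sum_congr rfl fun j _ => ?_
  split_ifs with h
  · rw [Nat.cast_sub h]
    push_cast
    rfl
  · rw [finrank_polySyz_of_neg (fun i => by positivity) _ (hE0 j), Nat.cast_zero]
    have : (t : ℤ) < (w 0 * (j : ℕ) : ℕ) := by exact_mod_cast not_le.1 h
    push_cast at this
    linarith

lemma hkSeries_genTup {d : ℕ} (w : Fin (n + 1) → ℕ) (hw : ∀ i, 1 ≤ w i)
    {F : MvPolynomial (Fin n) k}
    (hF : IsWeightedHomogeneous (fun i => (w (Fin.succ i) : ℤ)) F (d * w 0))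
    {I : Ideal (MvPolynomial (Fin (n + 1)) k)}
    (hI : I = Ideal.span {X 0 ^ d - rename Fin.succ F}) {m l : ℕ}
    (V : Fin (m + l) → MvPolynomial (Fin n) k) (dv : Fin (m + l) → ℕ) (q : ℕ) {r : ℕ}
    (hr : r < d) :
    hkSeries k (fun i => (w i : ℤ)) I
        (genTup m l (Ideal.Quotient.mk I (X 0)) (d * q + r)
          fun j => Ideal.Quotient.mk I (rename Fin.succ (V j)))
        (degTup m l (w 0 * ((d * q + r : ℕ) : ℤ)) fun j => (dv j : ℤ)) =
      ∑ j ∈ Finset.range d, (PowerSeries.X ^ w 0) ^ j *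
        polySyzSeries (fun i => (w (Fin.succ i) : ℤ))
          (genTup m l F (if r ≤ j then q else q + 1) V)
          (degTup m l (w 0 * ((d * if r ≤ j then q else q + 1 : ℕ) : ℤ))
            fun j => (dv j : ℤ)) := by
  have : NeZero d := ⟨by omega⟩
  have hσ : ∀ j : Fin d, d * q + r + (j - ⟨r, hr⟩ : Fin d).val =
      j + d * if r ≤ (j : ℕ) then q else q + 1 := by
    intro j
    split_ifs with h
    · rw [Fin.sub_val_of_le (show ⟨r, hr⟩ ≤ j from h)]
      simp only
      omega
    · rw [Fin.coe_sub_iff_lt.2 (show j < ⟨r, hr⟩ from not_le.1 h), mul_add]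
      simp only
      omega
  rw [Finset.sum_range]
  refine hkSeries_eq_sum (by omega) w hw hF hI
    (fun i => if (i : ℕ) < m then Equiv.subRight ⟨r, hr⟩ else Equiv.refl _) ?_ ?_ ?_
  · intro i j
    by_cases hi : (i : ℕ) < m
    · simp only [genTup, hi, if_true, Equiv.subRight_apply, map_mul, map_pow, ← mk_X_pow_eq hI]
      rw [← mul_assoc, ← pow_add, add_comm (j - _ : Fin d).val, hσ, pow_add, pow_mul]
      ring
    · simp [genTup, hi, mul_comm]
  · intro j i
    unfold degTup
    split_ifs <;> positivity
  · intro i j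
    by_cases hi : (i : ℕ) < m
    · simp only [degTup, hi, if_true, Equiv.subRight_apply]
      have h : ((d * q + r : ℕ) : ℤ) + ((j - ⟨r, hr⟩ : Fin d) : ℕ) =
          (j : ℕ) + ((d * if r ≤ (j : ℕ) then q else q + 1 : ℕ) : ℤ) := by exact_mod_cast hσ j
      linear_combination (w 0 : ℤ) * h
    · simp [degTup, hi, add_comm]

end Syzygies

lemma one_sub_pow_mul_sum_ite {S : Type*} [CommRing S] (u : S) (h : ℕ → S) (q : ℕ) {r d : ℕ}
    (hr : r ≤ d) :
    (1 - u ^ d) * ∑ j ∈ Finset.range d, u ^ j * h (if r ≤ j then q else q + 1) =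
      (u ^ r - u ^ d) * ((∑ j ∈ Finset.range d, u ^ j) * h q) +
        (1 - u ^ r) * ((∑ j ∈ Finset.range d, u ^ j) * h (q + 1)) := by
  have hsplit : ∑ j ∈ Finset.range d, u ^ j * h (if r ≤ j then q else q + 1) =
      (∑ j ∈ Finset.range r, u ^ j) * h (q + 1) +
        ((∑ j ∈ Finset.range d, u ^ j) - ∑ j ∈ Finset.range r, u ^ j) * h q := by
    rw [← Finset.sum_Ico_eq_sub _ hr, ← Finset.sum_range_add_sum_Ico _ hr, Finset.sum_mul,
      Finset.sum_mul]
    congr 1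
    · exact Finset.sum_congr rfl fun j hj => by rw [if_neg (not_le.2 (Finset.mem_range.1 hj))]
    · exact Finset.sum_congr rfl fun j hj => by rw [if_pos (Finset.mem_Ico.1 hj).1]
  rw [hsplit]
  linear_combination
    (∑ j ∈ Finset.range r, u ^ j) * (h q - h (q + 1)) * mul_neg_geom_sum u d +
      (∑ j ∈ Finset.range d, u ^ j) * (h (q + 1) - h q) * mul_neg_geom_sum u r

/-- Let `R = k[X, Y₁,…,Yₙ]/(X^d - F(Y₁,…,Yₙ))` be positively graded with `deg X = w 0`,
let `V₁,…,V_{m+l}` be monomials in the `Yⱼ`, and write `a = dq + r`, `0 ≤ r ≤ d-1`.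
With `M_a := Syz_R(X^a V₁,…,X^a V_m, V_{m+1},…,V_{m+l})` and
`𝒮_j := Syz_R(F^j V₁,…,F^j V_m, V_{m+1},…,V_{m+l})`, the Hilbert series satisfies
`H_{M_a}(t) = ((t^{αr} - t^{αd})·H_{𝒮_q}(t) + (1 - t^{αr})·H_{𝒮_{q+1}}(t))/(1 - t^{αd})`
(stated with cleared denominator, `α = w 0`). -/
theorem stmt12 (k : Type*) [Field k] (n : ℕ) (w : Fin (n + 1) → ℕ) (hw : ∀ i, 1 ≤ w i)
    (d : ℕ) (hd : 1 ≤ d) (F : MvPolynomial (Fin (n + 1)) k)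
    (hFY : ∀ μ ∈ F.support, μ 0 = 0)
    (hFhom : IsWeightedHomogeneous (fun i => (w i : ℤ)) F ((d * w 0 : ℕ) : ℤ))
    (m l : ℕ) (hm : 1 ≤ m) (hl : 1 ≤ l)
    (V : Fin (m + l) → MvPolynomial (Fin (n + 1)) k) (dv : Fin (m + l) → ℕ)
    (hV : ∀ j, ∃ μ : Fin (n + 1) →₀ ℕ, μ 0 = 0 ∧ V j = monomial μ 1)
    (hVdeg : ∀ j, IsWeightedHomogeneous (fun i => (w i : ℤ)) (V j) ((dv j : ℤ)))
    (a q r : ℕ) (ha : a = d * q + r) (hr : r < d) :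
    ∀ I : Ideal (MvPolynomial (Fin (n + 1)) k), I = Ideal.span {X 0 ^ d - F} →
    ∀ x : MvPolynomial (Fin (n + 1)) k ⧸ I, x = Ideal.Quotient.mk I (X 0) →
    ∀ xF : MvPolynomial (Fin (n + 1)) k ⧸ I, xF = Ideal.Quotient.mk I F →
    ∀ v : Fin (m + l) → MvPolynomial (Fin (n + 1)) k ⧸ I,
      v = (fun j => Ideal.Quotient.mk I (V j)) →
      (1 - (PowerSeries.X : PowerSeries ℚ) ^ (w 0 * d)) *
          hkSeries k (fun i => (w i : ℤ)) I (genTup m l x a v)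
            (degTup m l (((w 0 : ℕ) : ℤ) * (a : ℤ)) (fun j => (dv j : ℤ))) =
        ((PowerSeries.X : PowerSeries ℚ) ^ (w 0 * r) -
            (PowerSeries.X : PowerSeries ℚ) ^ (w 0 * d)) *
          hkSeries k (fun i => (w i : ℤ)) I (genTup m l xF q v)
            (degTup m l (((w 0 : ℕ) : ℤ) * ((d * q : ℕ) : ℤ)) (fun j => (dv j : ℤ))) +
        (1 - (PowerSeries.X : PowerSeries ℚ) ^ (w 0 * r)) *
          hkSeries k (fun i => (w i : ℤ)) I (genTup m l xF (q + 1) v)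
            (degTup m l (((w 0 : ℕ) : ℤ) * ((d * (q + 1) : ℕ) : ℤ)) (fun j => (dv j : ℤ))) := by
  rintro I hI _ rfl _ rfl _ rfl
  obtain ⟨F, rfl⟩ := exists_rename_succ_eq hFY
  have hV' : ∀ j, ∃ p : MvPolynomial (Fin n) k, rename Fin.succ p = V j := by
    intro j
    obtain ⟨μ, hμ, hVj⟩ := hV j
    refine exists_rename_succ_eq fun ν hν => ?_
    rw [hVj] at hν
    rwa [Finset.mem_singleton.1 (support_monomial_subset hν)]
  choose V₀ hV₀ using hV'
  obtain rfl : (fun j => rename Fin.succ (V₀ j)) = V := funext hV₀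
  have hF : IsWeightedHomogeneous (fun i => (w (Fin.succ i) : ℤ)) F (d * w 0) := by
    rw [Nat.cast_mul] at hFhom
    exact (isWeightedHomogeneous_rename_iff (Fin.succ_injective n) _ _ _).1 hFhom
  let h : ℕ → PowerSeries ℚ := fun c =>
    polySyzSeries (fun i => (w (Fin.succ i) : ℤ)) (genTup m l F c V₀)
      (degTup m l (w 0 * ((d * c : ℕ) : ℤ)) fun j => (dv j : ℤ))
  have hS : ∀ c, hkSeries k (fun i => (w i : ℤ)) I
      (genTup m l (Ideal.Quotient.mk I (rename Fin.succ F)) c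
        fun j => Ideal.Quotient.mk I (rename Fin.succ (V₀ j)))
      (degTup m l (w 0 * ((d * c : ℕ) : ℤ)) fun j => (dv j : ℤ)) =
        (∑ j ∈ Finset.range d, (PowerSeries.X ^ w 0) ^ j) * h c := by
    intro c
    have hc := hkSeries_genTup w hw hF hI V₀ dv c (show 0 < d from hd)
    simp only [Nat.zero_le, if_true, ← Finset.sum_mul, add_zero] at hc
    rw [← hc]
    congr 1
    funext j
    simp only [genTup, pow_mul, mk_X_pow_eq hI]
  rw [ha, hkSeries_genTup w hw hF hI V₀ dv q hr, hS, hS, pow_mul, pow_mul]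
  exact one_sub_pow_mul_sum_ite _ h q hr.le
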